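/- Let x, y, h : ℝ → ℝ be functions, with x and y three times differentiable and h twice differentiable in a neighborhood of a point s₀, and suppose x'(t)² + y'(t)² > 0 for all t in that neighborhood. Define the unit normal components n₁ = y'/(x'² + y'²)^{1/2} and n₂ = -x'/(x'² + y'²)^{1/2}, and for each ε ∈ ℝ define the perturbed coordinate functions x_ε = x + ε·h·n₁ and y_ε = y + ε·h·n₂, with signed curvature H_ε(t) = (x_ε'(t)·y_ε''(t) - x_ε''(t)·y_ε'(t)) / (x_ε'(t)² + y_ε'(t)²)^{3/2}. Then the map ε ↦ H_ε(s₀) is differentiable at ε = 0 and its derivative equals -H₀(s₀)²·h(s₀) + ((x'(s₀)·x''(s₀) + y'(s₀)·y''(s₀))/(x'(s₀)² + y'(s₀)²)²)·h'(s₀) - h''(s₀)/(x'(s₀)² + y'(s₀)²). -/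

import Mathlib

open Filter Topology

theorem deriv_and_deriv_deriv_eq {f f₁ : ℝ → ℝ} {f₂ s : ℝ}
    (hf : ∀ᶠ t in 𝓝 s, HasDerivAt f (f₁ t) t) (hf₁ : HasDerivAt f₁ f₂ s) :
    deriv f s = f₁ s ∧ deriv (deriv f) s = f₂ :=
  ⟨hf.self_of_nhds.deriv,
    (hf₁.congr_of_eventuallyEq (hf.mono fun _ ht => ht.deriv)).deriv⟩

/-- Derivative at `ε = 0` of the curvature expression when the first and second derivatives of
the two coordinates depend affinely on `ε`. -/
theorem hasDerivAt_curvature_affine (a b c d a₁ b₁ c₁ d₁ : ℝ) {w : ℝ} (hw : 0 < w)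
    (hw2 : w ^ 2 = a ^ 2 + c ^ 2) :
    HasDerivAt (fun ε : ℝ => ((a + ε * a₁) * (d + ε * d₁) - (b + ε * b₁) * (c + ε * c₁)) /
        ((a + ε * a₁) ^ 2 + (c + ε * c₁) ^ 2) ^ ((3 : ℝ) / 2))
      ((a₁ * d + a * d₁ - b₁ * c - b * c₁) / w ^ 3
        - 3 * (a * d - b * c) * (a * a₁ + c * c₁) / w ^ 5) 0 := by
  have affine (p q : ℝ) : HasDerivAt (fun ε : ℝ => p + ε * q) q 0 := by
    simpa using ((hasDerivAt_id (0 : ℝ)).mul_const q).const_add p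
  have hnum := ((affine a a₁).mul (affine d d₁)).sub ((affine b b₁).mul (affine c c₁))
  have hbase := ((affine a a₁).pow 2).add ((affine c c₁).pow 2)
  have hbase0 : (a + 0 * a₁) ^ 2 + (c + 0 * c₁) ^ 2 = w ^ 2 := by rw [hw2]; ring
  have hpow3 : (w ^ 2) ^ ((3 : ℝ) / 2) = w ^ 3 := by
    rw [← Real.rpow_natCast_mul hw.le, ← Real.rpow_natCast]
    norm_num
  have hpow1 : (w ^ 2) ^ ((3 : ℝ) / 2 - 1) = w := by
    rw [← Real.rpow_natCast_mul hw.le]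
    norm_num
  have hden := hbase.rpow_const (p := (3 : ℝ) / 2) (Or.inl (by
    simp only [Pi.add_apply, Pi.pow_apply, hbase0]; positivity))
  have hquot := hnum.div hden (by
    simp only [Pi.add_apply, Pi.pow_apply, hbase0, hpow3]; positivity)
  refine hquot.congr_deriv ?_
  simp only [Pi.add_apply, Pi.pow_apply, Pi.mul_apply, Pi.sub_apply, hbase0, hpow3, hpow1]
  field_simp
  ring

/-- The algebraic identity behind the curvature variation, in terms of the quotient `u` of the
amplitude by the speed `w`. -/
theorem curvature_variation_identity {a b c d e k u u₁ u₂ w w₁ w₂ : ℝ} (hw : 0 < w)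
    (hw2 : w ^ 2 = a ^ 2 + c ^ 2) (hw₁ : w₁ * w = a * b + c * d)
    (hw₂ : w₂ * w + w₁ * w₁ = b * b + a * e + (d * d + c * k)) :
    ((u₁ * c + u * d) * d + a * -(u₂ * a + 2 * u₁ * b + u * e)
        - (u₂ * c + 2 * u₁ * d + u * k) * c - b * -(u₁ * a + u * b)) / w ^ 3
      - 3 * (a * d - b * c) * (a * (u₁ * c + u * d) + c * -(u₁ * a + u * b)) / w ^ 5
    = -((a * d - b * c) / w ^ 3) ^ 2 * (u * w)
      + ((a * b + c * d) / (w ^ 2) ^ 2) * (u₁ * w + u * w₁)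
      - (u₂ * w + 2 * u₁ * w₁ + u * w₂) / w ^ 2 := by
  have hlagrange : (b ^ 2 + d ^ 2) * w ^ 2 = (a * d - b * c) ^ 2 + w ^ 2 * w₁ ^ 2 := by
    linear_combination (b ^ 2 + d ^ 2) * hw2 - (w₁ * w + (a * b + c * d)) * hw₁
  have hvar : (u₁ * c + u * d) * d + a * -(u₂ * a + 2 * u₁ * b + u * e)
        - (u₂ * c + 2 * u₁ * d + u * k) * c - b * -(u₁ * a + u * b)
      = -u₂ * w ^ 2 - u₁ * (w₁ * w) + u * (2 * (b ^ 2 + d ^ 2) - w₂ * w - w₁ ^ 2) := by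
    linear_combination u₂ * hw2 + u₁ * hw₁ + u * hw₂
  have hradial : a * (u₁ * c + u * d) + c * -(u₁ * a + u * b) = u * (a * d - b * c) := by ring
  rw [hvar, hradial, ← hw₁]
  field_simp
  linear_combination 2 * u * hlagrange

/-- Fréchet derivative of the signed curvature of a planar curve with respect to
a normal perturbation: for a regular curve `γ = (x, y)` and a normal perturbation
with scalar amplitude `h`, the derivative at `ε = 0` of the signed curvature of the
perturbed curve `γ_ε = γ + ε·h·n`, evaluated at `s₀`, equals
`-H₀(s₀)²·h(s₀) + ((x'x'' + y'y'')/(x'² + y'²)²)(s₀)·h'(s₀) - h''(s₀)/(x'² + y'²)(s₀)`. -/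
theorem curvature_frechet_derivative
    (x y h : ℝ → ℝ) (s₀ : ℝ) (U : Set ℝ) (hU : U ∈ nhds s₀)
    (hx : DifferentiableOn ℝ x U) (hx' : DifferentiableOn ℝ (deriv x) U)
    (hx'' : DifferentiableOn ℝ (deriv (deriv x)) U)
    (hy : DifferentiableOn ℝ y U) (hy' : DifferentiableOn ℝ (deriv y) U)
    (hy'' : DifferentiableOn ℝ (deriv (deriv y)) U)
    (hh : DifferentiableOn ℝ h U) (hh' : DifferentiableOn ℝ (deriv h) U)
    (hreg : ∀ t ∈ U, 0 < (deriv x t) ^ 2 + (deriv y t) ^ 2)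
    (n₁ n₂ : ℝ → ℝ)
    (hn₁ : n₁ = fun t => deriv y t / Real.sqrt ((deriv x t) ^ 2 + (deriv y t) ^ 2))
    (hn₂ : n₂ = fun t => -deriv x t / Real.sqrt ((deriv x t) ^ 2 + (deriv y t) ^ 2))
    (xE yE : ℝ → ℝ → ℝ)
    (hxE : xE = fun ε t => x t + ε * h t * n₁ t)
    (hyE : yE = fun ε t => y t + ε * h t * n₂ t)
    (H : ℝ → ℝ → ℝ)
    (hH : H = fun ε t =>
      (deriv (xE ε) t * deriv (deriv (yE ε)) t - deriv (deriv (xE ε)) t * deriv (yE ε) t) /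
        ((deriv (xE ε) t) ^ 2 + (deriv (yE ε) t) ^ 2) ^ ((3 : ℝ) / 2)) :
    HasDerivAt (fun ε => H ε s₀)
      (-(H 0 s₀) ^ 2 * h s₀
        + ((deriv x s₀ * deriv (deriv x) s₀ + deriv y s₀ * deriv (deriv y) s₀) /
            ((deriv x s₀) ^ 2 + (deriv y s₀) ^ 2) ^ 2) * deriv h s₀
        - deriv (deriv h) s₀ / ((deriv x s₀) ^ 2 + (deriv y s₀) ^ 2)) 0 := by
  set v : ℝ → ℝ := fun t => Real.sqrt ((deriv x t) ^ 2 + (deriv y t) ^ 2) with hv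
  set v₁ : ℝ → ℝ := fun t =>
    (deriv x t * deriv (deriv x) t + deriv y t * deriv (deriv y) t) / v t with hv₁
  set u : ℝ → ℝ := fun t => h t / v t with hu
  set u₁ : ℝ → ℝ := fun t => (deriv h t * v t - h t * v₁ t) / v t ^ 2 with hu₁
  have near {f : ℝ → ℝ} (hf : DifferentiableOn ℝ f U) :
      ∀ᶠ t in 𝓝 s₀, HasDerivAt f (deriv f t) t := by
    filter_upwards [eventually_mem_nhds_iff.2 hU] with t ht
    exact (hf.differentiableAt ht).hasDerivAt
  have hvpos : ∀ᶠ t in 𝓝 s₀, 0 < v t := by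
    filter_upwards [hU] with t ht using Real.sqrt_pos.2 (hreg t ht)
  have hvd : ∀ᶠ t in 𝓝 s₀, HasDerivAt v (v₁ t) t := by
    filter_upwards [hU, near hx', near hy'] with t ht hxt hyt
    refine (((hxt.pow 2).add (hyt.pow 2)).sqrt (hreg t ht).ne').congr_deriv ?_
    have := (Real.sqrt_pos.2 (hreg t ht)).ne'
    simp only [hv₁, hv, Pi.add_apply, Pi.pow_apply]
    field_simp
    ring
  have hud : ∀ᶠ t in 𝓝 s₀, HasDerivAt u (u₁ t) t := by
    filter_upwards [hvpos, near hh, hvd] with t hpos hht hvt using hht.div hvt hpos.ne'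
  have hx2 := (near hx').self_of_nhds
  have hx3 := (near hx'').self_of_nhds
  have hy2 := (near hy').self_of_nhds
  have hy3 := (near hy'').self_of_nhds
  have hw : 0 < v s₀ := hvpos.self_of_nhds
  have hv0 := hvd.self_of_nhds
  have hu0 := hud.self_of_nhds
  have hspeed : HasDerivAt (fun t => deriv x t * deriv (deriv x) t
      + deriv y t * deriv (deriv y) t) _ s₀ := (hx2.mul hx3).add (hy2.mul hy3)
  obtain ⟨v₂, hv2⟩ : ∃ v₂, HasDerivAt v₁ v₂ s₀ := ⟨_, hspeed.div hv0 hw.ne'⟩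
  obtain ⟨u₂, hu2⟩ : ∃ u₂, HasDerivAt u₁ u₂ s₀ :=
    ⟨_, (((near hh').self_of_nhds.mul hv0).sub ((near hh).self_of_nhds.mul hv2)).div
      (hv0.pow 2) (pow_ne_zero 2 hw.ne')⟩
  have hw2 : v s₀ ^ 2 = deriv x s₀ ^ 2 + deriv y s₀ ^ 2 :=
    Real.sq_sqrt (hreg s₀ (mem_of_mem_nhds hU)).le
  have hw₁ : v₁ s₀ * v s₀ = deriv x s₀ * deriv (deriv x) s₀
      + deriv y s₀ * deriv (deriv y) s₀ := div_mul_cancel₀ _ hw.ne'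
  have hw₂ := (hv2.mul hv0).unique (hspeed.congr_of_eventuallyEq
    (hvpos.mono fun t ht => div_mul_cancel₀ _ ht.ne'))
  have hhd : h s₀ = u s₀ * v s₀ ∧ deriv h s₀ = u₁ s₀ * v s₀ + u s₀ * v₁ s₀ ∧
      deriv (deriv h) s₀ = u₂ * v s₀ + 2 * u₁ s₀ * v₁ s₀ + u s₀ * v₂ := by
    have heq : h =ᶠ[𝓝 s₀] fun t => u t * v t :=
      hvpos.mono fun t ht => (div_mul_cancel₀ _ ht.ne').symm
    refine ⟨heq.self_of_nhds, deriv_and_deriv_deriv_eq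
      (f₁ := fun t => u₁ t * v t + u t * v₁ t) ?_ ?_⟩
    · filter_upwards [heq.eventually_nhds, hud, hvd] with t het hut hvt
      exact (hut.mul hvt).congr_of_eventuallyEq het
    · exact ((hu2.mul hv0).add (hu0.mul hv2)).congr_deriv (by ring)
  have hX (ε : ℝ) : deriv (xE ε) s₀ = deriv x s₀
        + ε * (u₁ s₀ * deriv y s₀ + u s₀ * deriv (deriv y) s₀) ∧
      deriv (deriv (xE ε)) s₀ = deriv (deriv x) s₀
        + ε * (u₂ * deriv y s₀ + 2 * u₁ s₀ * deriv (deriv y) s₀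
          + u s₀ * deriv (deriv (deriv y)) s₀) := by
    have heq : xE ε = fun t => x t + ε * (u t * deriv y t) := by
      funext t; simp only [hxE, hn₁, hu, hv]; ring
    rw [heq]
    refine deriv_and_deriv_deriv_eq (f₁ := fun t => deriv x t
      + ε * (u₁ t * deriv y t + u t * deriv (deriv y) t)) ?_ ?_
    · filter_upwards [near hx, near hy', hud] with t hxt hyt hut
      exact hxt.add ((hut.mul hyt).const_mul ε)
    · exact (hx2.add (((hu2.mul hy2).add (hu0.mul hy3)).const_mul ε)).congr_deriv (by ring)
  have hY (ε : ℝ) : deriv (yE ε) s₀ = deriv y s₀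
        + ε * -(u₁ s₀ * deriv x s₀ + u s₀ * deriv (deriv x) s₀) ∧
      deriv (deriv (yE ε)) s₀ = deriv (deriv y) s₀
        + ε * -(u₂ * deriv x s₀ + 2 * u₁ s₀ * deriv (deriv x) s₀
          + u s₀ * deriv (deriv (deriv x)) s₀) := by
    have heq : yE ε = fun t => y t + ε * -(u t * deriv x t) := by
      funext t; simp only [hyE, hn₂, hu, hv]; ring
    rw [heq]
    refine deriv_and_deriv_deriv_eq (f₁ := fun t => deriv y t
      + ε * -(u₁ t * deriv x t + u t * deriv (deriv x) t)) ?_ ?_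
    · filter_upwards [near hy, near hx', hud] with t hyt hxt hut
      exact hyt.add ((hut.mul hxt).neg.const_mul ε)
    · exact (hy2.add (((hu2.mul hx2).add (hu0.mul hx3)).neg.const_mul ε)).congr_deriv (by ring)
  have hH0 : H 0 s₀ = (deriv x s₀ * deriv (deriv y) s₀ - deriv (deriv x) s₀ * deriv y s₀)
      / v s₀ ^ 3 := by
    simp only [hH, (hX 0).1, (hX 0).2, (hY 0).1, (hY 0).2, zero_mul, add_zero, ← hw2]
    rw [← Real.rpow_natCast_mul hw.le, ← Real.rpow_natCast]
    norm_num
  rw [hH0, hhd.1, hhd.2.1, hhd.2.2, ← hw2, ← curvature_variation_identity hw hw2 hw₁ hw₂]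
  simp only [hH, fun ε => (hX ε).1, fun ε => (hX ε).2, fun ε => (hY ε).1, fun ε => (hY ε).2]
  exact hasDerivAt_curvature_affine _ _ _ _ _ _ _ _ hw hw2
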